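/- Let K be a field of characteristic 0, let 𝒜 be a full rank supersolvable arrangement of n lines in ℙ²(K) with maximum multiplicity m := m(𝒜) ≥ 3, let P be a point of multiplicity m (hence modular), and let 𝒜_h be the subarrangement of the lines of 𝒜 not passing through P. Then equality |Sing₂(𝒜)| = 2·|Sing(𝒜)| − m(n − m) − 2 holds if and only if 𝒜_h is generic (every singular point of 𝒜_h is simple), and in that case |Sing₂(𝒜)| = (n − m)(2m − n + 1). -/

import Mathlib

open scoped Classical

/-- A point of the projective plane over `K`. -/
abbrev Pt (K : Type*) [Field K] := Projectivization K (Fin 3 → K)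

/-- A (candidate) line arrangement: a finite set of linear subspaces of `K³`. -/
abbrev Arr (K : Type*) [Field K] := Finset (Submodule K (Fin 3 → K))

/-- Every member of `A` is a projective line, i.e. a 2-dimensional linear subspace of `K³`. -/
def IsLineArr {K : Type*} [Field K] (A : Arr K) : Prop :=
  ∀ L ∈ A, Module.finrank K L = 2

/-- The multiplicity `m(P, A)`: the number of lines of `A` passing through `P`. -/
noncomputable def multAt {K : Type*} [Field K] (A : Arr K) (P : Pt K) : ℕ :=
  (A.filter fun L => P.submodule ≤ L).card

/-- `Sing(A)`: the set of points lying on at least two lines of `A`. -/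
def SingSet {K : Type*} [Field K] (A : Arr K) : Set (Pt K) :=
  {P | 2 ≤ multAt A P}

/-- `Sing₂(A)`: the set of simple points, i.e. singular points of multiplicity exactly 2. -/
def Sing2Set {K : Type*} [Field K] (A : Arr K) : Set (Pt K) :=
  {P | multAt A P = 2}

/-- `m(A)`: the maximum multiplicity of a singular point of `A`. -/
noncomputable def maxMult {K : Type*} [Field K] (A : Arr K) : ℕ :=
  sSup (multAt A '' SingSet A)

/-- `P` is a modular point of `A`: it is singular, and for every other singular point `Q`
the line through `P` and `Q` belongs to `A`. -/
def IsModular {K : Type*} [Field K] (A : Arr K) (P : Pt K) : Prop :=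
  P ∈ SingSet A ∧ ∀ Q ∈ SingSet A, Q ≠ P → (P.submodule ⊔ Q.submodule) ∈ A

/-- `A` is supersolvable: it has a modular point. -/
def Supersolvable {K : Type*} [Field K] (A : Arr K) : Prop :=
  ∃ P, IsModular A P

/-- `A` has full rank (rank 3): its lines have no common point. -/
def FullRank {K : Type*} [Field K] (A : Arr K) : Prop :=
  (⨅ L ∈ A, L) = ⊥

section Incidence

variable {K : Type*} [Field K]

/-- Two distinct points lie on at most one common line. -/
theorem line_eq_of_two_points {P Q : Pt K} (hPQ : P ≠ Q) {L M : Submodule K (Fin 3 → K)}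
    (hL : Module.finrank K L = 2) (hM : Module.finrank K M = 2)
    (hPL : P.submodule ≤ L) (hQL : Q.submodule ≤ L)
    (hPM : P.submodule ≤ M) (hQM : Q.submodule ≤ M) : L = M := by
  have hinf : 2 ≤ Module.finrank K ↥(L ⊓ M) := by
    by_contra! hlt
    have hP := Submodule.eq_of_le_of_finrank_le (le_inf hPL hPM)
      (by rw [Projectivization.finrank_submodule]; omega)
    have hQ := Submodule.eq_of_le_of_finrank_le (le_inf hQL hQM)
      (by rw [Projectivization.finrank_submodule]; omega)
    exact hPQ (Projectivization.submodule_injective (hP.trans hQ.symm))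
  exact (Submodule.eq_of_le_of_finrank_le inf_le_left (hL.trans_le hinf)).symm.trans
    (Submodule.eq_of_le_of_finrank_le inf_le_right (hM.trans_le hinf))

/-- Any two lines of the projective plane meet. -/
theorem exists_common_point {L M : Submodule K (Fin 3 → K)}
    (hL : Module.finrank K L = 2) (hM : Module.finrank K M = 2) :
    ∃ Q : Pt K, Q.submodule ≤ L ∧ Q.submodule ≤ M := by
  have hsum := Submodule.finrank_sup_add_finrank_inf_eq L M
  have hsup : Module.finrank K ↥(L ⊔ M) ≤ 3 := by
    simpa using Submodule.finrank_le (L ⊔ M)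
  have hne : L ⊓ M ≠ ⊥ := by
    intro h
    rw [h, finrank_bot] at hsum
    omega
  obtain ⟨v, hv, hv0⟩ := Submodule.exists_mem_ne_zero_of_ne_bot hne
  refine ⟨Projectivization.mk K v hv0, ?_, ?_⟩ <;>
    rw [Projectivization.submodule_mk, Submodule.span_singleton_le_iff_mem]
  exacts [hv.1, hv.2]

theorem mem_singSet_of_two_lines {A : Arr K} {Q : Pt K} {L M : Submodule K (Fin 3 → K)}
    (hL : L ∈ A) (hM : M ∈ A) (hLM : L ≠ M) (hQL : Q.submodule ≤ L) (hQM : Q.submodule ≤ M) :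
    Q ∈ SingSet A :=
  Finset.one_lt_card.2
    ⟨L, Finset.mem_filter.2 ⟨hL, hQL⟩, M, Finset.mem_filter.2 ⟨hM, hQM⟩, hLM⟩

theorem exists_two_lines_of_mem_singSet {A : Arr K} {Q : Pt K} (hQ : Q ∈ SingSet A) :
    ∃ L ∈ A, ∃ M ∈ A, L ≠ M ∧ Q.submodule ≤ L ∧ Q.submodule ≤ M := by
  obtain ⟨L, hL, M, hM, hLM⟩ := Finset.one_lt_card.1 hQ
  rw [Finset.mem_filter] at hL hM
  exact ⟨L, hL.1, M, hM.1, hLM, hL.2, hM.2⟩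

/-- Choice of a common point of two lines; the value is arbitrary if there is none. -/
noncomputable def meetPoint [Nonempty (Pt K)] (L M : Submodule K (Fin 3 → K)) : Pt K :=
  Classical.epsilon fun Q => Q.submodule ≤ L ∧ Q.submodule ≤ M

theorem meetPoint_le [Nonempty (Pt K)] {L M : Submodule K (Fin 3 → K)}
    (hL : Module.finrank K L = 2) (hM : Module.finrank K M = 2) :
    (meetPoint L M).submodule ≤ L ∧ (meetPoint L M).submodule ≤ M :=
  Classical.epsilon_spec (exists_common_point hL hM)

theorem eq_meetPoint [Nonempty (Pt K)] {L M : Submodule K (Fin 3 → K)}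
    (hL : Module.finrank K L = 2) (hM : Module.finrank K M = 2) (hLM : L ≠ M) {Q : Pt K}
    (hQL : Q.submodule ≤ L) (hQM : Q.submodule ≤ M) : meetPoint L M = Q := by
  by_contra hne
  have h := meetPoint_le hL hM
  exact hLM (line_eq_of_two_points hne hL hM h.1 hQL h.2 hQM)

theorem finite_singSet [Nonempty (Pt K)] {A : Arr K} (hA : IsLineArr A) :
    (SingSet A).Finite := by
  refine ((A ×ˢ A).image fun p => meetPoint p.1 p.2).finite_toSet.subset fun Q hQ => ?_
  obtain ⟨L, hL, M, hM, hLM, hQL, hQM⟩ := exists_two_lines_of_mem_singSet hQ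
  exact Finset.mem_coe.2 (Finset.mem_image.2 ⟨(L, M), Finset.mk_mem_product hL hM,
    eq_meetPoint (hA L hL) (hA M hM) hLM hQL hQM⟩)

theorem multAt_le_maxMult {A : Arr K} {Q : Pt K} (hQ : Q ∈ SingSet A) :
    multAt A Q ≤ maxMult A := by
  refine le_csSup ⟨A.card, ?_⟩ ⟨Q, hQ, rfl⟩
  rintro _ ⟨R, -, rfl⟩
  exact Finset.card_filter_le _ _

/-- Every singular point is joined to `P` by a line of `A`. -/
def JoinsSing (A : Arr K) (P : Pt K) : Prop :=
  ∀ Q ∈ SingSet A, Q ≠ P → ∃ L ∈ A, P.submodule ≤ L ∧ Q.submodule ≤ L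

theorem IsModular.joinsSing {A : Arr K} {P : Pt K} (h : IsModular A P) : JoinsSing A P :=
  fun Q hQ hQP => ⟨_, h.2 Q hQ hQP, le_sup_left, le_sup_right⟩

/-- A singular point that is not modular has smaller multiplicity than any modular point. -/
theorem multAt_lt_of_not_joinsSing {A : Arr K} (hA : IsLineArr A) {P Q : Pt K}
    (hQ : JoinsSing A Q) (hP : P ∈ SingSet A) (hnP : ¬ JoinsSing A P) :
    multAt A P < multAt A Q := by
  have : Nonempty (Pt K) := ⟨P⟩
  unfold JoinsSing at hnP
  push Not at hnP
  obtain ⟨R, hR, hRP, hRn⟩ := hnP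
  have hPQ : P ≠ Q := by
    rintro rfl
    obtain ⟨L, hL, h1, h2⟩ := hQ R hR hRP
    exact hRn L hL h1 h2
  have hRQ : R ≠ Q := by
    rintro rfl
    obtain ⟨L, hL, h1, h2⟩ := hQ P hP hPQ
    exact hRn L hL h2 h1
  obtain ⟨M, hM, hRM, hQM⟩ : ∃ M ∈ A, R.submodule ≤ M ∧ ¬ Q.submodule ≤ M := by
    obtain ⟨L, hL, M, hM, hLM, hRL, hRM⟩ := exists_two_lines_of_mem_singSet hR
    by_cases h : Q.submodule ≤ L
    · exact ⟨M, hM, hRM, fun h' =>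
        hLM (line_eq_of_two_points hRQ (hA L hL) (hA M hM) hRL h hRM h')⟩
    · exact ⟨L, hL, hRL, h⟩
  have hPM : ¬ P.submodule ≤ M := fun h => hRn M hM h hRM
  -- Project the lines through `P` from `M` to the pencil at `Q`.
  have key : ∀ L ∈ A.filter fun L => P.submodule ≤ L, ∃ N ∈ A,
      Q.submodule ≤ N ∧ (meetPoint L M).submodule ≤ N := by
    intro L hL
    rw [Finset.mem_filter] at hL
    have hm := meetPoint_le (hA L hL.1) (hA M hM)
    have hLM : L ≠ M := fun h => hPM (h ▸ hL.2)
    refine hQ _ (mem_singSet_of_two_lines hL.1 hM hLM hm.1 hm.2) fun h => hQM ?_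
    rw [← h]; exact hm.2
  choose! f hfA hfQ hfm using key
  obtain ⟨N, hN, hQN, hRN⟩ := hQ R hR hRQ
  have hinj : ∀ L ∈ A.filter (fun L => P.submodule ≤ L), ∀ S : Pt K, S.submodule ≤ M →
      S.submodule ≤ f L → S = meetPoint L M := by
    intro L hL S hSM hSf
    by_contra hne
    have hL' := Finset.mem_filter.1 hL
    have hm := meetPoint_le (hA L hL'.1) (hA M hM)
    have := line_eq_of_two_points hne (hA M hM) (hA _ (hfA L hL)) hSM hm.2 hSf (hfm L hL)
    exact hQM (this ▸ hfQ L hL)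
  have hsub : (A.filter fun L => P.submodule ≤ L).image f ⊆
      (A.filter fun L => Q.submodule ≤ L).erase N := by
    intro X hX
    obtain ⟨L, hL, rfl⟩ := Finset.mem_image.1 hX
    have hL' := Finset.mem_filter.1 hL
    refine Finset.mem_erase.2 ⟨fun h => ?_, Finset.mem_filter.2 ⟨hfA L hL, hfQ L hL⟩⟩
    have hRL := hinj L hL R hRM (by rw [h]; exact hRN)
    refine hRn L hL'.1 hL'.2 ?_
    rw [hRL]
    exact (meetPoint_le (hA L hL'.1) (hA M hM)).1
  have hcard := Finset.card_le_card hsub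
  rw [Finset.card_image_of_injOn, Finset.card_erase_of_mem
    (Finset.mem_filter.2 ⟨hN, hQN⟩)] at hcard
  · have hpos : 0 < multAt A Q := Finset.card_pos.2 ⟨N, Finset.mem_filter.2 ⟨hN, hQN⟩⟩
    have hle : multAt A P ≤ multAt A Q - 1 := hcard
    omega
  · intro L hL L' hL' hff
    have h1 := Finset.mem_filter.1 (Finset.mem_coe.1 hL)
    have h2 := Finset.mem_filter.1 (Finset.mem_coe.1 hL')
    have hm := meetPoint_le (hA L h1.1) (hA M hM)
    have hm' := meetPoint_le (hA L' h2.1) (hA M hM)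
    have hff' : f L = f L' := hff
    have heq := hinj L' hL' _ hm.2 (by rw [← hff']; exact hfm L hL)
    refine line_eq_of_two_points (P := P) (Q := meetPoint L M) (fun h => hPM ?_)
      (hA L h1.1) (hA L' h2.1) h1.2 hm.1 h2.2 (heq ▸ hm'.1)
    rw [h]; exact hm.2

/-- The lines of `A` not through `P`. -/
noncomputable abbrev linesOff (A : Arr K) (P : Pt K) : Arr K :=
  A.filter fun L => ¬ P.submodule ≤ L

theorem multAt_linesOff_self (A : Arr K) (P : Pt K) : multAt (linesOff A P) P = 0 := by
  simp [multAt, linesOff]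

theorem singSet_linesOff_subset (A : Arr K) (P : Pt K) : SingSet (linesOff A P) ⊆ SingSet A :=
  fun _ hQ => le_trans hQ
    (Finset.card_le_card (Finset.filter_subset_filter _ (Finset.filter_subset _ _)))

theorem multAt_eq_multAt_linesOff_add_one {A : Arr K} (hA : IsLineArr A) {P Q : Pt K}
    (hP : JoinsSing A P) (hQ : Q ∈ SingSet A) (hQP : Q ≠ P) :
    multAt A Q = multAt (linesOff A P) Q + 1 := by
  obtain ⟨L, hL, hPL, hQL⟩ := hP Q hQ hQP
  have h1 : ((A.filter fun M => Q.submodule ≤ M).filter fun M => P.submodule ≤ M) = {L} := by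
    ext M
    simp only [Finset.mem_filter, Finset.mem_singleton]
    constructor
    · rintro ⟨⟨hM, hQM⟩, hPM⟩
      exact line_eq_of_two_points hQP (hA M hM) (hA L hL) hQM hPM hQL hPL
    · rintro rfl
      exact ⟨⟨hL, hQL⟩, hPL⟩
  have h2 := Finset.card_filter_add_card_filter_not (s := A.filter fun M => Q.submodule ≤ M)
    (fun M => P.submodule ≤ M)
  rw [h1, Finset.card_singleton, Finset.filter_comm] at h2
  unfold multAt linesOff
  omega

theorem sum_multAt_linesOff {A : Arr K} (hA : IsLineArr A) {P : Pt K} (hP : JoinsSing A P)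
    {T : Finset (Pt K)} (hT : ∀ Q, Q ∈ T ↔ Q ∈ SingSet A ∧ Q ≠ P) :
    ∑ Q ∈ T, multAt (linesOff A P) Q = multAt A P * (linesOff A P).card := by
  have : Nonempty (Pt K) := ⟨P⟩
  have hswap := Finset.sum_card_bipartiteAbove_eq_sum_card_bipartiteBelow
    (s := T) (t := linesOff A P) (fun Q L => Q.submodule ≤ L)
  refine hswap.trans ((Finset.sum_const_nat fun L hL => ?_).trans (mul_comm _ _))
  rw [Finset.mem_filter] at hL
  have hne : ∀ M : Submodule K (Fin 3 → K), P.submodule ≤ M → M ≠ L :=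
    fun M hM h => hL.2 (h ▸ hM)
  symm
  refine Finset.card_bij (fun M _ => meetPoint M L) ?_ ?_ ?_
  · intro M hM
    rw [Finset.mem_filter] at hM
    have hm := meetPoint_le (hA M hM.1) (hA L hL.1)
    refine Finset.mem_filter.2 ⟨(hT _).2
      ⟨mem_singSet_of_two_lines hM.1 hL.1 (hne M hM.2) hm.1 hm.2, fun h => hL.2 ?_⟩, hm.2⟩
    rw [← h]; exact hm.2
  · intro M hM M' hM' h
    rw [Finset.mem_filter] at hM hM'
    have hm := meetPoint_le (hA M hM.1) (hA L hL.1)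
    have hm' := meetPoint_le (hA M' hM'.1) (hA L hL.1)
    refine line_eq_of_two_points (P := P) (Q := meetPoint M L) (fun h => hL.2 ?_)
      (hA M hM.1) (hA M' hM'.1) hM.2 hm.1 hM'.2 (by rw [h]; exact hm'.1)
    rw [h]; exact hm.2
  · intro Q hQ
    obtain ⟨hQT, hQL⟩ := Finset.mem_filter.1 hQ
    obtain ⟨hQs, hQP⟩ := (hT Q).1 hQT
    obtain ⟨M, hM, hPM, hQM⟩ := hP Q hQs hQP
    exact ⟨M, Finset.mem_filter.2 ⟨hM, hPM⟩,
      eq_meetPoint (hA M hM) (hA L hL.1) (hne M hPM) hQM hQL⟩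

/-- Counting the ordered pairs of distinct lines by their intersection point. -/
theorem sum_multAt_mul_pred {A : Arr K} (hA : IsLineArr A) {T : Finset (Pt K)}
    (hT : SingSet A ⊆ T) :
    ∑ Q ∈ T, (multAt A Q * multAt A Q - multAt A Q) = A.card * A.card - A.card := by
  by_cases hne : Nonempty (Pt K)
  swap
  · rw [not_nonempty_iff] at hne
    have hcard : A.card ≤ 1 := by
      refine Finset.card_le_one.2 fun L hL M hM => ?_
      exact isEmptyElim (exists_common_point (hA L hL) (hA M hM)).choose
    rw [Finset.sum_of_isEmpty]
    interval_cases A.card <;> rfl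
  rw [← Finset.offDiag_card, Finset.card_eq_sum_card_fiberwise (t := T)
    (f := fun p : Submodule K (Fin 3 → K) × Submodule K (Fin 3 → K) => meetPoint p.1 p.2)]
  · refine Finset.sum_congr rfl fun Q _ => ?_
    rw [multAt, ← Finset.offDiag_card]
    congr 1
    ext ⟨L, M⟩
    simp only [Finset.mem_offDiag, Finset.mem_filter]
    constructor
    · rintro ⟨⟨hL, hQL⟩, ⟨hM, hQM⟩, hLM⟩
      exact ⟨⟨hL, hM, hLM⟩, eq_meetPoint (hA L hL) (hA M hM) hLM hQL hQM⟩
    · rintro ⟨⟨hL, hM, hLM⟩, rfl⟩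
      have hm := meetPoint_le (hA L hL) (hA M hM)
      exact ⟨⟨hL, hm.1⟩, ⟨hM, hm.2⟩, hLM⟩
  · rintro ⟨L, M⟩ h
    obtain ⟨hL, hM, hLM⟩ := Finset.mem_offDiag.1 (Finset.mem_coe.1 h)
    have hm := meetPoint_le (hA L hL) (hA M hM)
    exact hT (mem_singSet_of_two_lines hL hM hLM hm.1 hm.2)

end Incidence

/-- Over a field of characteristic 0, for a full rank supersolvable
arrangement of `n` lines with maximum multiplicity `m := m(A) ≥ 3`, modular point `P` of
multiplicity `m`, and `A_h` the subarrangement of lines not through `P`, equality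
`|Sing₂(A)| = 2·|Sing(A)| − m(n − m) − 2` holds iff `A_h` is generic, and in that case
`|Sing₂(A)| = (n − m)(2m − n + 1)`. -/
theorem sing2_lower_bound_equality {K : Type*} [Field K] [CharZero K] (A : Arr K)
    (hA : IsLineArr A) (hfr : FullRank A) (hss : Supersolvable A) (hm : 3 ≤ maxMult A)
    (P : Pt K) (hP : P ∈ SingSet A) (hPmax : multAt A P = maxMult A) :
    (((Sing2Set A).ncard : ℤ) =
        2 * ((SingSet A).ncard : ℤ) - (maxMult A : ℤ) * ((A.card : ℤ) - (maxMult A : ℤ)) - 2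
      ↔ SingSet (A.filter fun L => ¬ P.submodule ≤ L) ⊆
          Sing2Set (A.filter fun L => ¬ P.submodule ≤ L)) ∧
    (SingSet (A.filter fun L => ¬ P.submodule ≤ L) ⊆
        Sing2Set (A.filter fun L => ¬ P.submodule ≤ L) →
      ((Sing2Set A).ncard : ℤ) =
        ((A.card : ℤ) - (maxMult A : ℤ)) * (2 * (maxMult A : ℤ) - (A.card : ℤ) + 1)) := by
  have : Nonempty (Pt K) := ⟨P⟩
  have hJ : JoinsSing A P := by
    obtain ⟨Q, hQ⟩ := hss
    by_contra hn
    have h1 := multAt_lt_of_not_joinsSing hA hQ.joinsSing hP hn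
    have h2 := multAt_le_maxMult hQ.1
    omega
  set S := (finite_singSet hA).toFinset with hS
  set T := S.erase P with hTdef
  have hT : ∀ Q, Q ∈ T ↔ Q ∈ SingSet A ∧ Q ≠ P := fun Q => by
    simp [hTdef, hS, and_comm]
  have hcardS : (SingSet A).ncard = T.card + 1 := by
    rw [Set.ncard_eq_toFinset_card _ (finite_singSet hA), hTdef,
      Finset.card_erase_add_one ((Set.Finite.mem_toFinset _).2 hP)]
  change ((_ : ℤ) = _ ↔ SingSet (linesOff A P) ⊆ Sing2Set (linesOff A P)) ∧
    (SingSet (linesOff A P) ⊆ Sing2Set (linesOff A P) → _)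
  have hcardA : A.card = maxMult A + (linesOff A P).card := by
    rw [← hPmax]
    exact (Finset.card_filter_add_card_filter_not (s := A) fun L => P.submodule ≤ L).symm
  have hmult : ∀ Q ∈ T, multAt A Q = multAt (linesOff A P) Q + 1 := fun Q hQ =>
    multAt_eq_multAt_linesOff_add_one hA hJ ((hT Q).1 hQ).1 ((hT Q).1 hQ).2
  have hpos : ∀ Q ∈ T, 1 ≤ multAt (linesOff A P) Q := fun Q hQ => by
    have h1 : 2 ≤ multAt A Q := ((hT Q).1 hQ).1
    have h2 := hmult Q hQ
    omega
  have hsub : SingSet (linesOff A P) ⊆ T := fun Q hQ => (hT Q).2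
    ⟨singSet_linesOff_subset A P hQ, by
      rintro rfl
      have h : 2 ≤ multAt (linesOff A Q) Q := hQ
      rw [multAt_linesOff_self] at h
      omega⟩
  have hcard2 : (Sing2Set A).ncard =
      ∑ Q ∈ T, if multAt (linesOff A P) Q = 1 then 1 else 0 := by
    rw [← Finset.card_filter, ← Set.ncard_coe_finset]
    congr 1
    ext Q
    rw [Finset.mem_coe, Finset.mem_filter]
    constructor
    · intro hQ
      have hQ2 : multAt A Q = 2 := hQ
      have hQT : Q ∈ T := (hT Q).2 ⟨hQ2.ge, by rintro rfl; omega⟩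
      have := hmult Q hQT
      exact ⟨hQT, by omega⟩
    · rintro ⟨hQT, h1⟩
      have := hmult Q hQT
      change multAt A Q = 2
      omega
  have hsum := sum_multAt_linesOff hA hJ hT
  rw [hPmax] at hsum
  have hgen : SingSet (linesOff A P) ⊆ Sing2Set (linesOff A P) ↔
      ∀ Q ∈ T, multAt (linesOff A P) Q ≤ 2 := by
    constructor
    · intro h Q _
      by_contra! hlt
      have h2 : multAt (linesOff A P) Q = 2 :=
        h (show 2 ≤ multAt (linesOff A P) Q by omega)
      omega
    · intro h Q hQ
      exact le_antisymm (h Q (hsub hQ)) hQ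
  have hdefect : 2 * T.card = (Sing2Set A).ncard + maxMult A * (linesOff A P).card ↔
      ∀ Q ∈ T, multAt (linesOff A P) Q ≤ 2 := by
    have hconst : 2 * T.card = ∑ Q ∈ T, 2 := by simp [mul_comm]
    have hle : ∀ Q ∈ T, 2 ≤ (if multAt (linesOff A P) Q = 1 then 1 else 0) +
        multAt (linesOff A P) Q := fun Q hQ => by
      have := hpos Q hQ
      split_ifs <;> omega
    rw [hcard2, ← hsum, ← Finset.sum_add_distrib, hconst]
    refine (Finset.sum_eq_sum_iff_of_le hle).trans (forall₂_congr fun Q hQ => ?_)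
    have := hpos Q hQ
    split_ifs <;> omega
  refine ⟨?_, fun h => ?_⟩
  · rw [hgen, ← hdefect, hcardS, hcardA]
    zify
    constructor <;> intro h <;> linarith
  · have hle := hgen.1 h
    have hA' : IsLineArr (linesOff A P) := fun L hL => hA L (Finset.mem_filter.1 hL).1
    have hpairs := sum_multAt_mul_pred hA' hsub
    have hsplit : ∑ Q ∈ T, multAt (linesOff A P) Q = (Sing2Set A).ncard +
        ∑ Q ∈ T, (multAt (linesOff A P) Q * multAt (linesOff A P) Q -
          multAt (linesOff A P) Q) := by
      rw [hcard2, ← Finset.sum_add_distrib]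
      refine Finset.sum_congr rfl fun Q hQ => ?_
      have h1 := hpos Q hQ
      have h2 := hle Q hQ
      interval_cases multAt (linesOff A P) Q <;> rfl
    rw [hpairs, hsum] at hsplit
    have hsq : (linesOff A P).card ≤ (linesOff A P).card * (linesOff A P).card :=
      Nat.le_mul_self _
    rw [hcardA]
    zify [hsq] at hsplit
    push_cast
    linarith
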